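/- Let α ∈ (0,2] and λ ≥ 0. Let H: ℝ^d → ℝ^d be continuously differentiable with |H(x)| ≤ L₀ + L₁|x| and |∇H(x)| ≤ L₂ for all x, and with I_d + ∇H(x) invertible and |(I_d + ∇H(x))^{−1}| ≤ N_κ for all x; let H̃(x) = x + H(x) with inverse H̃^{−1}(x) = x + F(x), F(x) = −H(H̃^{−1}(x)). Then there is a constant N = N(d, λ, α, L₀, L₁, L₂, N_κ) such that for every v: ℝ^d → ℝ^m with |r₁^{−λ}v|_α < ∞ (v continuously differentiable when α > 1) and every x ∈ ℝ^d: r₁(x)^{−λ−α} |v(H̃(x)) − v(x) + 1_{(1,2]}(α) F^i(x) ∂_i v(x)| ≤ N |r₁^{−λ}v|_α ( |r₁^{−1}H|₀^α + |r₁^{−1}H|₀ [H]₁ + |r₁^{−1}H|₀^{[α]⁻+1} + [H]₁^{[α]⁻+1} ), with summation over i = 1,…,d. -/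

import Mathlib

open scoped ENNReal RealInnerProductSpace

noncomputable section

/-- `ℝ^d` with the Euclidean norm. -/
abbrev Euc (d : ℕ) : Type := EuclideanSpace ℝ (Fin d)

/-- The weight `r₁(x) = (1 + |x|²)^{1/2}`. -/
def r1 {d : ℕ} (x : Euc d) : ℝ := Real.sqrt (1 + ‖x‖ ^ 2)

/-- Sup-norm `|f|₀ = sup_x ‖f x‖`, valued in `[0,∞]`. -/
def nrm0 {d : ℕ} {V : Type*} [NormedAddCommGroup V] (f : Euc d → V) : ℝ≥0∞ :=
  ⨆ x, (‖f x‖₊ : ℝ≥0∞)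

/-- Hölder seminorm `[f]_β = sup_{x ≠ y} ‖f x - f y‖ / ‖x - y‖^β`, valued in `[0,∞]`. -/
def hsemi {d : ℕ} {V : Type*} [NormedAddCommGroup V] (β : ℝ) (f : Euc d → V) : ℝ≥0∞ :=
  ⨆ (x : Euc d) (y : Euc d) (_ : x ≠ y),
    (‖f x - f y‖₊ : ℝ≥0∞) / ENNReal.ofReal (‖x - y‖ ^ β)

/-- Partial derivative in the `i`-th coordinate direction. -/
def pder {d : ℕ} {V : Type*} [NormedAddCommGroup V] [NormedSpace ℝ V]
    (i : Fin d) (f : Euc d → V) : Euc d → V :=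
  fun x => fderiv ℝ f x (EuclideanSpace.single i 1)

/-- Iterated partial derivative in the `i`-th coordinate direction. -/
def pderPow {d : ℕ} {V : Type*} [NormedAddCommGroup V] [NormedSpace ℝ V]
    (i : Fin d) : ℕ → (Euc d → V) → Euc d → V
  | 0, f => f
  | n + 1, f => pder i (pderPow i n f)

/-- Multi-index partial derivative `∂^γ f = ∂_1^{γ 1} ⋯ ∂_d^{γ d} f`. -/
def mder {d : ℕ} {V : Type*} [NormedAddCommGroup V] [NormedSpace ℝ V]
    (γ : Fin d → ℕ) (f : Euc d → V) : Euc d → V :=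
  (List.finRange d).foldr (fun i g => pderPow i (γ i) g) f

/-- `[β]⁻`: for `β > 0`, the nonnegative integer with `β = [β]⁻ + {β}⁺`, `{β}⁺ ∈ (0,1]`. -/
def ifl (β : ℝ) : ℕ := ⌈β⌉₊ - 1

/-- `{β}⁺`: the fractional part in `(0,1]` of `β > 0`. -/
def frc (β : ℝ) : ℝ := β - (ifl β : ℝ)

/-- Hölder norm `|f|_β = Σ_{|γ| ≤ [β]⁻} |∂^γ f|₀ + Σ_{|γ| = [β]⁻} [∂^γ f]_{{β}⁺}`,
valued in `[0,∞]`. -/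
def holNorm {d : ℕ} {V : Type*} [NormedAddCommGroup V] [NormedSpace ℝ V]
    (β : ℝ) (f : Euc d → V) : ℝ≥0∞ :=
  (∑' γ : {γ : Fin d → ℕ // (∑ i, γ i) ≤ ifl β}, nrm0 (mder γ.1 f))
    + ∑' γ : {γ : Fin d → ℕ // (∑ i, γ i) = ifl β}, hsemi (frc β) (mder γ.1 f)

/-- `H̃(x) = x + H(x)`. -/
def tilde {d : ℕ} (H : Euc d → Euc d) : Euc d → Euc d := fun x => x + H x

/-- `H̃⁻¹`, the inverse map of `H̃`. -/
def tildeInv {d : ℕ} (H : Euc d → Euc d) : Euc d → Euc d := Function.invFun (tilde H)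

/-- `F(x) = H̃⁻¹(x) - x`, so that `H̃⁻¹(x) = x + F(x)`. -/
def Fof {d : ℕ} (H : Euc d → Euc d) : Euc d → Euc d := fun x => tildeInv H x - x

open Set

/-! ### Elementary facts about the weight -/

lemma r1_sq {d : ℕ} (x : Euc d) : r1 x ^ 2 = 1 + ‖x‖ ^ 2 :=
  Real.sq_sqrt (by positivity)

lemma one_le_r1 {d : ℕ} (x : Euc d) : 1 ≤ r1 x :=
  Real.one_le_sqrt.2 (by nlinarith [sq_nonneg ‖x‖])

lemma norm_le_r1 {d : ℕ} (x : Euc d) : ‖x‖ ≤ r1 x :=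
  Real.le_sqrt_of_sq_le (by linarith)

lemma r1_le_one_add_norm {d : ℕ} (x : Euc d) : r1 x ≤ 1 + ‖x‖ :=
  Real.sqrt_le_iff.2 ⟨by positivity, by nlinarith [norm_nonneg x]⟩

lemma r1_rpow {d : ℕ} (x : Euc d) (p : ℝ) : r1 x ^ p = (1 + ‖x‖ ^ 2) ^ (p / 2) := by
  rw [r1, Real.sqrt_eq_rpow, ← Real.rpow_mul (by positivity)]
  congr 1; ring

lemma hasFDerivAt_r1_rpow {d : ℕ} (x : Euc d) (p : ℝ) :
    HasFDerivAt (fun y : Euc d => r1 y ^ p) ((p * r1 x ^ p / r1 x ^ 2) • innerSL ℝ x) x := by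
  have hq : (0 : ℝ) < 1 + ‖x‖ ^ 2 := by positivity
  have h1 : HasFDerivAt (fun y : Euc d => 1 + ‖y‖ ^ 2) (2 • innerSL ℝ x) x :=
    (hasStrictFDerivAt_norm_sq x).hasFDerivAt.const_add 1
  have h2 := h1.rpow_const (p := p / 2) (Or.inl hq.ne')
  simp only [r1_rpow, r1_sq]
  have e : (p * (1 + ‖x‖ ^ 2) ^ (p / 2) / (1 + ‖x‖ ^ 2)) • innerSL ℝ x =
      (p / 2 * (1 + ‖x‖ ^ 2) ^ (p / 2 - 1)) • 2 • innerSL ℝ x := by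
    rw [Real.rpow_sub_one hq.ne', ← Nat.cast_smul_eq_nsmul ℝ, smul_smul]
    congr 1
    push_cast
    ring
  rw [e]
  exact h2

/-! ### Scalar Taylor estimates for powers -/

lemma exists_abs_rpow_sub_one_le (p : ℝ) :
    ∃ C, 0 ≤ C ∧ ∀ z ∈ Icc (1 / 2 : ℝ) (3 / 2), |z ^ p - 1| ≤ C * |z - 1| := by
  have hcont : ContinuousOn (fun z : ℝ => p * z ^ (p - 1)) (Icc (1 / 2 : ℝ) (3 / 2)) := by
    refine continuousOn_const.mul (ContinuousOn.rpow_const continuousOn_id fun z hz => Or.inl ?_)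
    exact (lt_of_lt_of_le (by norm_num) hz.1).ne'
  obtain ⟨C, hC⟩ := isCompact_Icc.exists_bound_of_continuousOn hcont
  refine ⟨C, (norm_nonneg _).trans (hC 1 (by norm_num)), fun z hz => ?_⟩
  have key := (convex_Icc (1 / 2 : ℝ) (3 / 2)).norm_image_sub_le_of_norm_hasDerivWithin_le
    (f := fun z : ℝ => z ^ p) (f' := fun z : ℝ => p * z ^ (p - 1)) (C := C) (x := 1) (y := z)
    (fun y hy => (Real.hasDerivAt_rpow_const
      (Or.inl (by have := hy.1; linarith))).hasDerivWithinAt) hC (by norm_num) hz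
  simpa using key

lemma exists_abs_rpow_sub_taylor_le_near (p : ℝ) :
    ∃ C, 0 ≤ C ∧ ∀ z ∈ Icc (1 / 2 : ℝ) (3 / 2),
      |z ^ p - 1 - p * (z - 1)| ≤ C * (z - 1) ^ 2 := by
  obtain ⟨C, hC0, hC⟩ := exists_abs_rpow_sub_one_le (p - 1)
  refine ⟨|p| * C, by positivity, fun z hz => ?_⟩
  have hsub : uIcc 1 z ⊆ Icc (1 / 2 : ℝ) (3 / 2) :=
    uIcc_subset_Icc (by norm_num) hz
  have key := (convex_uIcc 1 z).norm_image_sub_le_of_norm_hasDerivWithin_le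
    (f := fun y : ℝ => y ^ p - p * y) (f' := fun y : ℝ => p * y ^ (p - 1) - p * 1)
    (C := |p| * C * |z - 1|) (x := 1) (y := z)
    (fun y hy => ((Real.hasDerivAt_rpow_const
      (Or.inl (by have := (hsub hy).1; linarith))).sub
        ((hasDerivAt_id y).const_mul p)).hasDerivWithinAt) ?_ left_mem_uIcc right_mem_uIcc
  · have e : z ^ p - 1 - p * (z - 1) = z ^ p - p * z - ((1 : ℝ) ^ p - p * 1) := by
      rw [Real.one_rpow]; ring
    rw [e, ← sq_abs (z - 1)]
    calc _ ≤ |p| * C * |z - 1| * |z - 1| := by simpa only [Real.norm_eq_abs] using key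
      _ = _ := by ring
  · intro y hy
    rw [← mul_sub, norm_mul, Real.norm_eq_abs, Real.norm_eq_abs, mul_assoc]
    gcongr
    refine (hC y (hsub hy)).trans ?_
    gcongr ?_ * ?_
    exact abs_sub_left_of_mem_uIcc hy

lemma exists_abs_rpow_sub_taylor_le (p K : ℝ) (hp : 0 ≤ p) (hK : 0 ≤ K) :
    ∃ C, 0 ≤ C ∧ ∀ z ∈ Icc (0 : ℝ) K,
      |z ^ p - 1 - p * (z - 1)| ≤ C * (z - 1) ^ 2 := by
  obtain ⟨C, hC0, hC⟩ := exists_abs_rpow_sub_taylor_le_near p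
  have hKp : 0 ≤ K ^ p := Real.rpow_nonneg hK p
  refine ⟨C + 4 * (K ^ p + 1 + p * (K + 1)), by positivity, fun z hz => ?_⟩
  by_cases hz' : z ∈ Icc (1 / 2 : ℝ) (3 / 2)
  · refine (hC z hz').trans ?_
    gcongr
    have : 0 ≤ 4 * (K ^ p + 1 + p * (K + 1)) := by positivity
    linarith
  · have h1 : 1 ≤ 4 * (z - 1) ^ 2 := by
      by_contra! h
      exact hz' ⟨by nlinarith, by nlinarith⟩
    have h2 : z ^ p ≤ K ^ p := Real.rpow_le_rpow hz.1 hz.2 hp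
    have h3 : 0 ≤ z ^ p := Real.rpow_nonneg hz.1 p
    have h4 : |z ^ p - 1 - p * (z - 1)| ≤ K ^ p + 1 + p * (K + 1) := by
      rw [abs_le]
      constructor <;> nlinarith [mul_le_mul_of_nonneg_left hz.2 hp, mul_nonneg hp hz.1]
    have h5 : 0 ≤ K ^ p + 1 + p * (K + 1) := by positivity
    nlinarith [mul_nonneg hC0 (sq_nonneg (z - 1)), mul_le_mul_of_nonneg_left h1 h5]

/-- First and second order expansion of the weight `r₁^p` along increments of size at most a
multiple of `r₁`. -/
lemma exists_weight_expansion (p A : ℝ) (hp : 0 ≤ p) (hA : 0 ≤ A) :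
    ∃ C, 0 ≤ C ∧ ∀ (d : ℕ) (x h : Euc d) (t : ℝ), 0 ≤ t → t ≤ A → ‖h‖ ≤ t * r1 x →
      |r1 (x + h) ^ p - r1 x ^ p| ≤ C * r1 x ^ p * t ∧
      |r1 (x + h) ^ p - r1 x ^ p - p * r1 x ^ p / r1 x ^ 2 * ⟪x, h⟫| ≤ C * r1 x ^ p * t ^ 2 := by
  obtain ⟨C, hC0, hC⟩ :=
    exists_abs_rpow_sub_taylor_le (p / 2) ((1 + A) ^ 2) (by positivity) (by positivity)
  refine ⟨C * (2 + A) ^ 2 * (1 + A) + p * (2 + A), by positivity, fun d x h t ht htA hh => ?_⟩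
  have hr := one_le_r1 x
  have hr0 : 0 < r1 x := by linarith
  have hw : 0 < r1 x ^ p := Real.rpow_pos_of_pos hr0 p
  set s := ⟪x, h⟫ / r1 x ^ 2 with hs
  set e := ‖h‖ ^ 2 / r1 x ^ 2 with he
  have he0 : 0 ≤ e := by positivity
  have het : e ≤ t ^ 2 := by
    rw [he, div_le_iff₀ (by positivity), ← mul_pow]
    gcongr
  have hst : |s| ≤ t := by
    rw [hs, abs_div, abs_of_pos (a := r1 x ^ 2) (by positivity), div_le_iff₀ (by positivity)]
    calc |⟪x, h⟫| ≤ ‖x‖ * ‖h‖ := abs_real_inner_le_norm x h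
      _ ≤ r1 x * (t * r1 x) := by gcongr; exact norm_le_r1 x
      _ = _ := by ring
  set z := (1 + ‖x + h‖ ^ 2) / r1 x ^ 2 with hz
  have hz1 : z - 1 = 2 * s + e := by
    rw [hz, hs, he, norm_add_sq_real, div_sub_one (by positivity), ← mul_div_assoc, ← add_div,
      r1_sq]
    congr 1
    ring
  have hz0 : 0 ≤ z := by positivity
  have hzt : |z - 1| ≤ (2 + A) * t := by
    rw [hz1]
    calc |2 * s + e| ≤ 2 * |s| + e := by
          refine (abs_add_le _ _).trans ?_
          rw [abs_mul, abs_of_nonneg he0]; norm_num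
      _ ≤ 2 * t + A * t := by nlinarith
      _ = _ := by ring
  have hzK : z ≤ (1 + A) ^ 2 := by
    have h1 : z - 1 ≤ 2 * t + t ^ 2 := by rw [hz1]; linarith [le_abs_self s]
    nlinarith
  have hwz : r1 (x + h) ^ p = r1 x ^ p * z ^ (p / 2) := by
    rw [r1_rpow, r1_rpow, hz, r1_sq, ← Real.mul_rpow (by positivity) (by positivity)]
    congr 1
    field_simp
  have key := hC z ⟨hz0, hzK⟩
  have hzsq : (z - 1) ^ 2 ≤ (2 + A) ^ 2 * t ^ 2 := by
    rw [← sq_abs, ← mul_pow]; gcongr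
  have key2 : |z ^ (p / 2) - 1 - p / 2 * (z - 1)| ≤ C * ((2 + A) ^ 2 * t ^ 2) :=
    key.trans (by gcongr)
  have hCA : 0 ≤ C * (2 + A) ^ 2 := by positivity
  constructor
  · have e1 : r1 (x + h) ^ p - r1 x ^ p = r1 x ^ p * (z ^ (p / 2) - 1) := by rw [hwz]; ring
    have h2 : |z ^ (p / 2) - 1| ≤ (C * (2 + A) ^ 2 * (1 + A) + p * (2 + A)) * t := by
      calc |z ^ (p / 2) - 1|
          = |(z ^ (p / 2) - 1 - p / 2 * (z - 1)) + p / 2 * (z - 1)| := by congr 1; ring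
        _ ≤ C * ((2 + A) ^ 2 * t ^ 2) + p / 2 * ((2 + A) * t) := by
            refine (abs_add_le _ _).trans (add_le_add key2 ?_)
            rw [abs_mul, abs_of_nonneg (a := p / 2) (by positivity)]
            gcongr
        _ ≤ _ := by
            have : t ^ 2 ≤ (1 + A) * t := by nlinarith
            have h3 : 0 ≤ p / 2 * ((2 + A) * t) := by positivity
            nlinarith [mul_le_mul_of_nonneg_left this hCA]
    rw [e1, abs_mul, abs_of_pos hw]
    calc _ ≤ r1 x ^ p * ((C * (2 + A) ^ 2 * (1 + A) + p * (2 + A)) * t) := by gcongr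
      _ = _ := by ring
  · have e1 : r1 (x + h) ^ p - r1 x ^ p - p * r1 x ^ p / r1 x ^ 2 * ⟪x, h⟫
        = r1 x ^ p * ((z ^ (p / 2) - 1 - p / 2 * (z - 1)) + p / 2 * e) := by
      rw [hwz, hz1, hs]; ring
    rw [e1, abs_mul, abs_of_pos hw]
    have h2 : |(z ^ (p / 2) - 1 - p / 2 * (z - 1)) + p / 2 * e|
        ≤ (C * (2 + A) ^ 2 * (1 + A) + p * (2 + A)) * t ^ 2 := by
      refine (abs_add_le _ _).trans ?_
      rw [abs_of_nonneg (a := p / 2 * e) (by positivity)]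
      have h3 : p / 2 * e ≤ p / 2 * t ^ 2 := by gcongr
      have h4 : 0 ≤ C * (2 + A) ^ 2 * A * t ^ 2 := by positivity
      have h5 : 0 ≤ p * (1 + A) * t ^ 2 := by positivity
      have h6 : 0 ≤ p * t ^ 2 := by positivity
      linarith
    calc _ ≤ r1 x ^ p * ((C * (2 + A) ^ 2 * (1 + A) + p * (2 + A)) * t ^ 2) := by gcongr
      _ = _ := by ring

/-! ### Reading pointwise bounds off the norms -/

section Norms

variable {d : ℕ} {V : Type*} [NormedAddCommGroup V]

lemma norm_le_of_nrm0_le {f : Euc d → V} {E : ℝ≥0∞} (hE : E ≠ ⊤) (h : nrm0 f ≤ E) (x : Euc d) :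
    ‖f x‖ ≤ E.toReal := by
  have h1 : (‖f x‖₊ : ℝ≥0∞) ≤ E := (le_iSup (fun x => (‖f x‖₊ : ℝ≥0∞)) x).trans h
  simpa using ENNReal.toReal_mono hE h1

lemma nrm0_le_ofReal {f : Euc d → V} {c : ℝ} (h : ∀ x, ‖f x‖ ≤ c) :
    nrm0 f ≤ ENNReal.ofReal c :=
  iSup_le fun x => by
    rw [← enorm_eq_nnnorm, ← ofReal_norm]
    exact ENNReal.ofReal_le_ofReal (h x)

lemma norm_sub_le_of_hsemi_le {f : Euc d → V} {E : ℝ≥0∞} {β : ℝ} (hβ : 0 < β) (hE : E ≠ ⊤)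
    (h : hsemi β f ≤ E) (x y : Euc d) : ‖f x - f y‖ ≤ E.toReal * ‖x - y‖ ^ β := by
  rcases eq_or_ne x y with rfl | hxy
  · simp [Real.zero_rpow hβ.ne']
  have hpos : 0 < ‖x - y‖ ^ β := Real.rpow_pos_of_pos (norm_pos_iff.2 (sub_ne_zero.2 hxy)) β
  have h1 : (‖f x - f y‖₊ : ℝ≥0∞) / ENNReal.ofReal (‖x - y‖ ^ β) ≤ E :=
    (le_iSup₂_of_le x y (by rw [iSup_pos hxy])).trans h
  have h2 := ENNReal.toReal_mono hE h1
  rw [ENNReal.toReal_div, ENNReal.toReal_ofReal hpos.le, div_le_iff₀ hpos] at h2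
  simpa using h2

lemma hsemi_one_le_ofReal {f : Euc d → V} {c : ℝ} (h : ∀ x y, ‖f x - f y‖ ≤ c * ‖x - y‖) :
    hsemi 1 f ≤ ENNReal.ofReal c := by
  refine iSup_le fun x => iSup_le fun y => iSup_le fun hxy => ?_
  have hpos : 0 < ‖x - y‖ := norm_pos_iff.2 (sub_ne_zero.2 hxy)
  rw [Real.rpow_one, ← enorm_eq_nnnorm, ← ofReal_norm, ← ENNReal.ofReal_div_of_pos hpos]
  exact ENNReal.ofReal_le_ofReal ((div_le_iff₀ hpos).2 (h x y))

variable [NormedSpace ℝ V]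

lemma foldr_pderPow_zero (l : List (Fin d)) (f : Euc d → V) :
    l.foldr (fun i g => pderPow i ((0 : Fin d → ℕ) i) g) f = f := by
  induction l with
  | nil => rfl
  | cons a l ih => rw [List.foldr_cons, ih]; rfl

lemma mder_zero (f : Euc d → V) : mder 0 f = f := foldr_pderPow_zero _ f

lemma foldr_pderPow_single (i : Fin d) (f : Euc d → V) (l : List (Fin d)) (hl : l.Nodup) :
    l.foldr (fun j g => pderPow j ((Pi.single i 1 : Fin d → ℕ) j) g) f =
      if i ∈ l then pder i f else f := by
  induction l with
  | nil => simp
  | cons a l ih =>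
    rw [List.foldr_cons, ih hl.of_cons]
    have ha := (List.nodup_cons.1 hl).1
    rcases eq_or_ne a i with rfl | hai
    · simp [ha, pderPow]
    · simp [hai, hai.symm, pderPow]

lemma mder_single (i : Fin d) (f : Euc d → V) : mder (Pi.single i 1) f = pder i f := by
  rw [mder, foldr_pderPow_single i f _ (List.nodup_finRange d), if_pos (List.mem_finRange i)]

lemma nrm0_mder_le_holNorm {β : ℝ} (f : Euc d → V) {γ : Fin d → ℕ} (hγ : ∑ i, γ i ≤ ifl β) :
    nrm0 (mder γ f) ≤ holNorm β f :=
  (ENNReal.le_tsum (f := fun γ : {γ : Fin d → ℕ // (∑ i, γ i) ≤ ifl β} => nrm0 (mder γ.1 f))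
    ⟨γ, hγ⟩).trans le_self_add

lemma hsemi_mder_le_holNorm {β : ℝ} (f : Euc d → V) {γ : Fin d → ℕ} (hγ : ∑ i, γ i = ifl β) :
    hsemi (frc β) (mder γ f) ≤ holNorm β f :=
  (ENNReal.le_tsum (f := fun γ : {γ : Fin d → ℕ // (∑ i, γ i) = ifl β} =>
    hsemi (frc β) (mder γ.1 f)) ⟨γ, hγ⟩).trans le_add_self

lemma opNorm_le_of_basis (L : Euc d →L[ℝ] V) {B : ℝ} (hB : 0 ≤ B)
    (h : ∀ i, ‖L (EuclideanSpace.single i 1)‖ ≤ B) : ‖L‖ ≤ d * B := by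
  refine L.opNorm_le_bound (by positivity) fun x => ?_
  have hx : x = ∑ i, x i • EuclideanSpace.single i (1 : ℝ) := by
    simpa using ((EuclideanSpace.basisFun (Fin d) ℝ).sum_repr x).symm
  calc ‖L x‖ = ‖∑ i, x i • L (EuclideanSpace.single i 1)‖ := by
        conv_lhs => rw [hx, map_sum]
        simp only [map_smul]
    _ ≤ ∑ i : Fin d, ‖x‖ * B := by
        refine norm_sum_le_of_le _ fun i _ => ?_
        rw [norm_smul]
        exact mul_le_mul (PiLp.norm_apply_le x i) (h i) (norm_nonneg _) (norm_nonneg _)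
    _ = d * B * ‖x‖ := by simp; ring

lemma norm_le_holNorm {β : ℝ} {f : Euc d → V} (hf : holNorm β f ≠ ⊤) (x : Euc d) :
    ‖f x‖ ≤ (holNorm β f).toReal :=
  norm_le_of_nrm0_le hf (by simpa [mder_zero] using nrm0_mder_le_holNorm f (γ := 0) (by simp)) x

end Norms

lemma ifl_of_le_one {α : ℝ} (h0 : 0 < α) (h1 : α ≤ 1) : ifl α = 0 := by
  rw [ifl, (Nat.ceil_eq_iff one_ne_zero).2 ⟨by simpa using h0, by simpa using h1⟩, Nat.sub_self]

lemma ifl_of_one_lt {α : ℝ} (h1 : 1 < α) (h2 : α ≤ 2) : ifl α = 1 := by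
  rw [ifl, (Nat.ceil_eq_iff two_ne_zero).2 ⟨by simpa using h1, by simpa using h2⟩]

/-! ### Functions of Hölder order in `(1, 2]` -/

section HigherOrder

variable {d : ℕ} {V : Type*} [NormedAddCommGroup V] [NormedSpace ℝ V] {α : ℝ} {f : Euc d → V}

lemma norm_fderiv_le_holNorm (h1 : 1 < α) (h2 : α ≤ 2) (hf : holNorm α f ≠ ⊤) (x : Euc d) :
    ‖fderiv ℝ f x‖ ≤ d * (holNorm α f).toReal := by
  refine opNorm_le_of_basis _ ENNReal.toReal_nonneg fun i => ?_
  have := nrm0_mder_le_holNorm (β := α) f (γ := Pi.single i 1) (by simp [ifl_of_one_lt h1 h2])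
  rw [mder_single] at this
  exact norm_le_of_nrm0_le hf this x

lemma norm_fderiv_sub_le_holNorm (h1 : 1 < α) (h2 : α ≤ 2) (hf : holNorm α f ≠ ⊤)
    (x y : Euc d) :
    ‖fderiv ℝ f x - fderiv ℝ f y‖ ≤ d * ((holNorm α f).toReal * ‖x - y‖ ^ (α - 1)) := by
  refine opNorm_le_of_basis _ (by positivity) fun i => ?_
  have := hsemi_mder_le_holNorm (β := α) f (γ := Pi.single i 1) (by simp [ifl_of_one_lt h1 h2])
  rw [mder_single, frc, ifl_of_one_lt h1 h2, Nat.cast_one] at this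
  exact norm_sub_le_of_hsemi_le (by linarith) hf this x y

lemma norm_taylor_le_holNorm (h1 : 1 < α) (h2 : α ≤ 2) (hf : holNorm α f ≠ ⊤)
    (hd : Differentiable ℝ f) (x h : Euc d) :
    ‖f (x + h) - f x - fderiv ℝ f x h‖ ≤ d * (holNorm α f).toReal * ‖h‖ ^ α := by
  have key := (convex_closedBall x ‖h‖).norm_image_sub_le_of_norm_fderiv_le'
    (f := f) (φ := fderiv ℝ f x) (x := x) (y := x + h)
    (C := d * ((holNorm α f).toReal * ‖h‖ ^ (α - 1))) (fun z _ => hd z) (fun z hz => ?_)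
    (by simp) (by simp)
  · rw [add_sub_cancel_left] at key
    refine key.trans_eq ?_
    have : ‖h‖ ^ α = ‖h‖ ^ (α - 1) * ‖h‖ := by
      rw [← Real.rpow_add_one' (norm_nonneg h) (by linarith)]; simp
    rw [this]; ring
  · refine (norm_fderiv_sub_le_holNorm h1 h2 hf z x).trans ?_
    gcongr
    simpa [dist_eq_norm] using hz

end HigherOrder

/-! ### The inverse map -/

lemma norm_inverse_sub_le {d : ℕ} {Nκ : ℝ} {H Hi : Euc d → Euc d}
    (hH : ContDiff ℝ 1 H)
    (hB : ∀ x, ∃ B : Euc d →L[ℝ] Euc d,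
      (1 + fderiv ℝ H x) * B = 1 ∧ B * (1 + fderiv ℝ H x) = 1 ∧ ‖B‖ ≤ Nκ)
    (hl : Function.LeftInverse Hi (fun x => x + H x))
    (hr : Function.RightInverse Hi (fun x => x + H x)) (x y : Euc d) :
    ‖Hi x - Hi y‖ ≤ Nκ * ‖x - y‖ := by
  choose B hB1 hB2 hB3 using hB
  have hder : ∀ z, HasFDerivAt Hi (B (Hi z)) z := fun z => by
    let e : Euc d ≃L[ℝ] Euc d := ContinuousLinearEquiv.equivOfInverse
      (1 + fderiv ℝ H (Hi z)) (B (Hi z))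
      (fun u => DFunLike.congr_fun (hB2 (Hi z)) u) (fun u => DFunLike.congr_fun (hB1 (Hi z)) u)
    have h1 : HasStrictFDerivAt (fun x => x + H x) (e : Euc d →L[ℝ] Euc d) (Hi z) :=
      (hasStrictFDerivAt_id (Hi z)).add (hH.contDiffAt.hasStrictFDerivAt one_ne_zero)
    have h2 := (h1.to_local_left_inverse (g := Hi) (.of_forall hl)).hasFDerivAt
    have h3 : Hi z + H (Hi z) = z := hr z
    simp only [h3] at h2
    exact h2
  exact convex_univ.norm_image_sub_le_of_norm_hasFDerivWithin_le
    (fun z _ => (hder z).hasFDerivWithinAt) (fun z _ => hB3 (Hi z)) (mem_univ y) (mem_univ x)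

lemma r1_inverse_le {d : ℕ} {Nκ L₀ : ℝ} (hNκ : 0 ≤ Nκ) {H Hi : Euc d → Euc d}
    (h0 : ‖H 0‖ ≤ L₀) (hlip : ∀ x y, ‖Hi x - Hi y‖ ≤ Nκ * ‖x - y‖)
    (hl : Function.LeftInverse Hi (fun x => x + H x)) (x : Euc d) :
    r1 (Hi x) ≤ (1 + Nκ * (1 + L₀)) * r1 x := by
  have hz : Hi (H 0) = 0 := by simpa using hl 0
  have h1 := hlip x (H 0)
  rw [hz, sub_zero] at h1
  have h2 : ‖x - H 0‖ ≤ (1 + L₀) * r1 x := by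
    have h3 := norm_sub_le x (H 0)
    have h4 := norm_le_r1 x
    have h5 := one_le_r1 x
    nlinarith [norm_nonneg (H 0)]
  have h6 := r1_le_one_add_norm (Hi x)
  have h7 := one_le_r1 x
  nlinarith [mul_le_mul_of_nonneg_left h2 hNκ]

/-! ### The weighted increments -/

section Increments

variable {d m : ℕ} {α lam a A C : ℝ} {v : Euc d → Euc m}

lemma r1_rpow_smul_cancel (lam : ℝ) (v : Euc d → Euc m) (x : Euc d) :
    r1 x ^ lam • (r1 x ^ (-lam) • v x) = v x := by
  have hr : 0 < r1 x := zero_lt_one.trans_le (one_le_r1 x)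
  rw [smul_smul, ← Real.rpow_add hr, add_neg_cancel, Real.rpow_zero, one_smul]

/-- Increments of functions of weighted Hölder order in `(0, 1]`. -/
lemma norm_increment_le (h0 : 0 < α) (h1 : α ≤ 1) (haA : a ≤ A) (hC0 : 0 ≤ C)
    (hC : ∀ x h : Euc d, ‖h‖ ≤ a * r1 x → |r1 (x + h) ^ lam - r1 x ^ lam| ≤ C * r1 x ^ lam * a)
    (hv : holNorm α (fun x => r1 x ^ (-lam) • v x) ≠ ⊤) (x h : Euc d) (hh : ‖h‖ ≤ a * r1 x) :
    ‖v (x + h) - v x‖ ≤ r1 x ^ lam * (holNorm α (fun x => r1 x ^ (-lam) • v x)).toReal *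
      ((1 + C * A) * (a * r1 x) ^ α + C * a) := by
  set u : Euc d → Euc m := fun x => r1 x ^ (-lam) • v x with hu
  set M := (holNorm α u).toReal
  have hM : 0 ≤ M := ENNReal.toReal_nonneg
  have hvu : ∀ z, v z = r1 z ^ lam • u z := fun z => (r1_rpow_smul_cancel lam v z).symm
  have hw0 : ∀ z : Euc d, 0 ≤ r1 z ^ lam := fun z =>
    Real.rpow_nonneg (zero_le_one.trans (one_le_r1 z)) lam
  have hinc := hC x h hh
  have hwy : r1 (x + h) ^ lam ≤ r1 x ^ lam * (1 + C * A) := by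
    have := (abs_le.1 hinc).2
    have h2 : C * r1 x ^ lam * a ≤ C * r1 x ^ lam * A :=
      mul_le_mul_of_nonneg_left haA (mul_nonneg hC0 (hw0 x))
    linarith
  have hsemi_le : hsemi α u ≤ holNorm α u := by
    have := hsemi_mder_le_holNorm (β := α) u (γ := 0) (by simp [ifl_of_le_one h0 h1])
    simpa [mder_zero, frc, ifl_of_le_one h0 h1] using this
  have hu1 : ‖u (x + h) - u x‖ ≤ M * (a * r1 x) ^ α := by
    refine (norm_sub_le_of_hsemi_le h0 hv hsemi_le (x + h) x).trans ?_
    rw [add_sub_cancel_left]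
    gcongr
  have hu0 : ‖u x‖ ≤ M := norm_le_holNorm hv x
  have e : v (x + h) - v x = r1 (x + h) ^ lam • (u (x + h) - u x)
      + (r1 (x + h) ^ lam - r1 x ^ lam) • u x := by
    rw [hvu, hvu x, smul_sub, sub_smul]; abel
  rw [e]
  calc _ ≤ r1 (x + h) ^ lam * ‖u (x + h) - u x‖ + |r1 (x + h) ^ lam - r1 x ^ lam| * ‖u x‖ := by
        refine (norm_add_le _ _).trans_eq ?_
        rw [norm_smul, norm_smul, Real.norm_eq_abs, Real.norm_eq_abs, abs_of_nonneg (hw0 _)]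
    _ ≤ (r1 x ^ lam * (1 + C * A)) * (M * (a * r1 x) ^ α) + (C * r1 x ^ lam * a) * M :=
        add_le_add (mul_le_mul hwy hu1 (norm_nonneg _) ((hw0 _).trans hwy))
          (mul_le_mul hinc hu0 (norm_nonneg _) ((abs_nonneg _).trans hinc))
    _ = _ := by ring

lemma hasFDerivAt_of_weighted (hv : ContDiff ℝ 1 v) (x : Euc d) :
    HasFDerivAt v (r1 x ^ lam • fderiv ℝ (fun x => r1 x ^ (-lam) • v x) x
      + ((lam * r1 x ^ lam / r1 x ^ 2) • innerSL ℝ x).smulRight (r1 x ^ (-lam) • v x)) x := by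
  have hu : DifferentiableAt ℝ (fun x => r1 x ^ (-lam) • v x) x :=
    (hasFDerivAt_r1_rpow x (-lam)).differentiableAt.smul (hv.differentiable one_ne_zero x)
  have := (hasFDerivAt_r1_rpow x lam).smul hu.hasFDerivAt
  refine this.congr_of_eventuallyEq (.of_forall fun z => ?_)
  exact (r1_rpow_smul_cancel lam v z).symm

lemma norm_fderiv_weighted_le (h1 : 1 < α) (h2 : α ≤ 2) (hlam : 0 ≤ lam)
    (hv : holNorm α (fun x => r1 x ^ (-lam) • v x) ≠ ⊤) (hc : ContDiff ℝ 1 v) (x : Euc d) :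
    ‖fderiv ℝ v x‖ ≤
      r1 x ^ lam * (holNorm α (fun x => r1 x ^ (-lam) • v x)).toReal * (d + lam) := by
  have hr := one_le_r1 x
  have hr0 : 0 < r1 x := by linarith
  have hw : 0 < r1 x ^ lam := Real.rpow_pos_of_pos hr0 lam
  have hM := norm_fderiv_le_holNorm h1 h2 hv x
  have hM0 : ‖r1 x ^ (-lam) • v x‖ ≤ _ := norm_le_holNorm hv x
  rw [(hasFDerivAt_of_weighted (lam := lam) hc x).fderiv]
  set M := (holNorm α (fun x => r1 x ^ (-lam) • v x)).toReal
  refine (norm_add_le _ _).trans ?_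
  rw [norm_smul, ContinuousLinearMap.norm_smulRight_apply, norm_smul, innerSL_apply_norm,
    Real.norm_of_nonneg hw.le, Real.norm_of_nonneg (by positivity)]
  have h3 : lam * r1 x ^ lam / r1 x ^ 2 * ‖x‖ ≤ lam * r1 x ^ lam := by
    rw [div_mul_eq_mul_div, div_le_iff₀ (by positivity)]
    gcongr
    nlinarith [norm_le_r1 x]
  calc _ ≤ r1 x ^ lam * (d * M) + lam * r1 x ^ lam * M := by gcongr
    _ = _ := by ring

/-- First order Taylor remainders of functions of weighted Hölder order in `(1, 2]`. -/
lemma norm_taylor_weighted_le (h1 : 1 < α) (h2 : α ≤ 2) (haA : a ≤ A)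
    (hC0 : 0 ≤ C)
    (hC : ∀ x h : Euc d, ‖h‖ ≤ a * r1 x →
      |r1 (x + h) ^ lam - r1 x ^ lam| ≤ C * r1 x ^ lam * a ∧
      |r1 (x + h) ^ lam - r1 x ^ lam - lam * r1 x ^ lam / r1 x ^ 2 * ⟪x, h⟫|
        ≤ C * r1 x ^ lam * a ^ 2)
    (hv : holNorm α (fun x => r1 x ^ (-lam) • v x) ≠ ⊤) (hc : ContDiff ℝ 1 v)
    (x h : Euc d) (hh : ‖h‖ ≤ a * r1 x) :
    ‖v (x + h) - v x - fderiv ℝ v x h‖ ≤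
      r1 x ^ lam * (holNorm α (fun x => r1 x ^ (-lam) • v x)).toReal *
      ((1 + C * A) * d * (a * r1 x) ^ α + C * d * a ^ 2 * r1 x + C * a ^ 2) := by
  have hfd := (hasFDerivAt_of_weighted (lam := lam) hc x).fderiv
  set u : Euc d → Euc m := fun x => r1 x ^ (-lam) • v x with hu
  set M := (holNorm α u).toReal
  have hM : 0 ≤ M := ENNReal.toReal_nonneg
  have hvu : ∀ z, v z = r1 z ^ lam • u z := fun z => (r1_rpow_smul_cancel lam v z).symm
  have hw0 : ∀ z : Euc d, 0 ≤ r1 z ^ lam := fun z =>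
    Real.rpow_nonneg (zero_le_one.trans (one_le_r1 z)) lam
  obtain ⟨hinc, hinc2⟩ := hC x h hh
  have hwy : r1 (x + h) ^ lam ≤ r1 x ^ lam * (1 + C * A) := by
    have := (abs_le.1 hinc).2
    have h2 : C * r1 x ^ lam * a ≤ C * r1 x ^ lam * A :=
      mul_le_mul_of_nonneg_left haA (mul_nonneg hC0 (hw0 x))
    linarith
  have hud : Differentiable ℝ u := fun z =>
    (hasFDerivAt_r1_rpow z (-lam)).differentiableAt.smul (hc.differentiable one_ne_zero z)
  have hu2 : ‖u (x + h) - u x - fderiv ℝ u x h‖ ≤ d * M * (a * r1 x) ^ α := by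
    refine (norm_taylor_le_holNorm h1 h2 hv hud x h).trans ?_
    gcongr
  have hu1 : ‖fderiv ℝ u x h‖ ≤ d * M * (a * r1 x) :=
    ((fderiv ℝ u x).le_opNorm h).trans
      (mul_le_mul (norm_fderiv_le_holNorm h1 h2 hv x) hh (norm_nonneg _) (by positivity))
  have hu0 : ‖u x‖ ≤ M := norm_le_holNorm hv x
  have e : v (x + h) - v x - fderiv ℝ v x h =
      r1 (x + h) ^ lam • (u (x + h) - u x - fderiv ℝ u x h)
      + (r1 (x + h) ^ lam - r1 x ^ lam) • fderiv ℝ u x h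
      + (r1 (x + h) ^ lam - r1 x ^ lam - lam * r1 x ^ lam / r1 x ^ 2 * ⟪x, h⟫) • u x := by
    have hux : r1 x ^ (-lam) • v x = u x := rfl
    rw [hfd, hux, hvu, hvu x]
    simp only [add_apply, smul_apply, ContinuousLinearMap.smulRight_apply, innerSL_apply_apply,
      smul_sub, sub_smul, smul_eq_mul]
    abel
  rw [e]
  calc _ ≤ r1 (x + h) ^ lam * ‖u (x + h) - u x - fderiv ℝ u x h‖
        + |r1 (x + h) ^ lam - r1 x ^ lam| * ‖fderiv ℝ u x h‖
        + |r1 (x + h) ^ lam - r1 x ^ lam - lam * r1 x ^ lam / r1 x ^ 2 * ⟪x, h⟫| * ‖u x‖ := by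
        refine (norm_add₃_le).trans_eq ?_
        simp only [norm_smul, Real.norm_eq_abs, abs_of_nonneg (hw0 _)]
    _ ≤ (r1 x ^ lam * (1 + C * A)) * (d * M * (a * r1 x) ^ α)
        + (C * r1 x ^ lam * a) * (d * M * (a * r1 x)) + (C * r1 x ^ lam * a ^ 2) * M :=
        add_le_add (add_le_add (mul_le_mul hwy hu2 (norm_nonneg _) ((hw0 _).trans hwy))
          (mul_le_mul hinc hu1 (norm_nonneg _) ((abs_nonneg _).trans hinc)))
          (mul_le_mul hinc2 hu0 (norm_nonneg _) ((abs_nonneg _).trans hinc2))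
    _ = _ := by ring

end Increments

/-- pointwise weighted estimate \eqref{ineq:estimateofIntegralalpha2}. -/
theorem stmt_17 (d : ℕ) (hd : 1 ≤ d) (α lam L₀ L₁ L₂ Nκ : ℝ)
    (hα : α ∈ Set.Ioc (0 : ℝ) 2) (hlam : 0 ≤ lam)
    (hL₀ : 0 ≤ L₀) (hL₁ : 0 ≤ L₁) (hL₂ : 0 ≤ L₂) (hNκ : 0 < Nκ) :
    ∃ N : ℝ, 0 < N ∧
      ∀ (m : ℕ), 1 ≤ m →
      ∀ (H Hi : Euc d → Euc d), ContDiff ℝ 1 H →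
        (∀ x, ‖H x‖ ≤ L₀ + L₁ * ‖x‖) →
        (∀ x, ‖fderiv ℝ H x‖ ≤ L₂) →
        (∀ x, ∃ B : Euc d →L[ℝ] Euc d,
          (1 + fderiv ℝ H x) * B = 1 ∧ B * (1 + fderiv ℝ H x) = 1 ∧ ‖B‖ ≤ Nκ) →
        Function.LeftInverse Hi (fun x => x + H x) →
        Function.RightInverse Hi (fun x => x + H x) →
      ∀ v : Euc d → Euc m,
        holNorm α (fun x => r1 x ^ (-lam) • v x) ≠ ⊤ →
        (1 < α → ContDiff ℝ 1 v) →
        ∀ x : Euc d,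
          r1 x ^ (-(lam + α)) *
              ‖v (x + H x) - v x
                + Set.indicator (Set.Ioc (1 : ℝ) 2) (fun _ => (1 : ℝ)) α
                    • fderiv ℝ v x (Hi x - x)‖ ≤
            N * (holNorm α (fun x => r1 x ^ (-lam) • v x)).toReal *
              ((nrm0 (fun x => r1 x ^ (-(1 : ℝ)) • H x)).toReal ^ α
                + (nrm0 (fun x => r1 x ^ (-(1 : ℝ)) • H x)).toReal * (hsemi 1 H).toReal
                + (nrm0 (fun x => r1 x ^ (-(1 : ℝ)) • H x)).toReal ^ (ifl α + 1)
                + (hsemi 1 H).toReal ^ (ifl α + 1)) := by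
  set A := L₀ + L₁ with hA
  have hA0 : 0 ≤ A := by positivity
  obtain ⟨C, hC0, hC⟩ := exists_weight_expansion lam A hlam hA0
  set K := 1 + Nκ * (1 + L₀) with hK
  have hK0 : 0 ≤ K := by positivity
  refine ⟨(1 + C * A) * (1 + d) + C * (1 + d) + (d + lam) * K, by positivity, ?_⟩
  intro m _ H Hi hH hHgrow hHder hB hl hr v hv hvc x
  set a := (nrm0 (fun x => r1 x ^ (-(1 : ℝ)) • H x)).toReal with ha
  set b := (hsemi 1 H).toReal with hb
  set M := (holNorm α (fun x => r1 x ^ (-lam) • v x)).toReal with hM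
  have ha0 : 0 ≤ a := ENNReal.toReal_nonneg
  have hb0 : 0 ≤ b := ENNReal.toReal_nonneg
  have hM0 : 0 ≤ M := ENNReal.toReal_nonneg
  have hr1 : ∀ z : Euc d, 0 < r1 z := fun z => zero_lt_one.trans_le (one_le_r1 z)
  have hnrm : nrm0 (fun x => r1 x ^ (-(1 : ℝ)) • H x) ≤ ENNReal.ofReal A :=
    nrm0_le_ofReal fun z => by
      rw [Real.rpow_neg_one, norm_smul, norm_inv, Real.norm_of_nonneg (hr1 z).le,
        inv_mul_le_iff₀ (hr1 z)]
      refine (hHgrow z).trans ?_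
      nlinarith [norm_le_r1 z, one_le_r1 z]
  have hnrm_top : nrm0 (fun x => r1 x ^ (-(1 : ℝ)) • H x) ≠ ⊤ :=
    ne_top_of_le_ne_top ENNReal.ofReal_ne_top hnrm
  have haA : a ≤ A := ENNReal.toReal_le_of_le_ofReal hA0 hnrm
  have hHa : ∀ z, ‖H z‖ ≤ a * r1 z := fun z => by
    have := norm_le_of_nrm0_le hnrm_top le_rfl z
    rw [Real.rpow_neg_one, norm_smul, norm_inv, Real.norm_of_nonneg (hr1 z).le,
      inv_mul_le_iff₀ (hr1 z)] at this
    linarith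
  have hsem_top : hsemi 1 H ≠ ⊤ :=
    ne_top_of_le_ne_top ENNReal.ofReal_ne_top <| hsemi_one_le_ofReal fun y z =>
      convex_univ.norm_image_sub_le_of_norm_fderiv_le
        (fun w _ => hH.differentiable one_ne_zero w) (fun w _ => hHder w)
        (Set.mem_univ z) (Set.mem_univ y)
  have hHb : ∀ y z, ‖H y - H z‖ ≤ b * ‖y - z‖ := fun y z => by
    simpa using norm_sub_le_of_hsemi_le one_pos hsem_top le_rfl y z
  have hr0 := hr1 x
  have hr_one := one_le_r1 x
  have hcancel : r1 x ^ (-(lam + α)) * r1 x ^ lam = r1 x ^ (-α) := by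
    rw [← Real.rpow_add hr0]; congr 1; ring
  have hrα : r1 x ^ (-α) ≤ 1 := Real.rpow_le_one_of_one_le_of_nonpos hr_one (by linarith [hα.1])
  have hrα' : r1 x ^ (-α) * (a * r1 x) ^ α = a ^ α := by
    rw [Real.mul_rpow ha0 hr0.le, mul_left_comm, ← Real.rpow_add hr0]; simp
  have hρ : 0 ≤ r1 x ^ (-α) := Real.rpow_nonneg hr0.le _
  have haα : 0 ≤ a ^ α := Real.rpow_nonneg ha0 α
  have hpre : 0 ≤ r1 x ^ (-(lam + α)) := Real.rpow_nonneg hr0.le _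
  have hCA : 0 ≤ 1 + C * A := by positivity
  have hab : 0 ≤ a * b := mul_nonneg ha0 hb0
  rcases le_or_gt α 1 with h1 | h1
  · rw [Set.indicator_of_notMem (by simp [h1]), zero_smul, add_zero, ifl_of_le_one hα.1 h1,
      zero_add, pow_one, pow_one]
    have key := norm_increment_le hα.1 h1 haA hC0
      (fun y h hh => (hC d y h a ha0 haA hh).1) hv x (H x) (hHa x)
    calc _ ≤ r1 x ^ (-(lam + α)) * (r1 x ^ lam * M * ((1 + C * A) * (a * r1 x) ^ α + C * a)) :=
          mul_le_mul_of_nonneg_left key hpre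
      _ = M * ((1 + C * A) * (r1 x ^ (-α) * (a * r1 x) ^ α) + C * a * r1 x ^ (-α)) := by
          rw [← hcancel]; ring
      _ ≤ M * ((1 + C * A) * a ^ α + C * a * 1) := by rw [hrα']; gcongr
      _ ≤ M * (((1 + C * A) * (1 + d) + C * (1 + d) + (d + lam) * K)
            * (a ^ α + a * b + a + b)) := by
          gcongr
          have t1 : 0 ≤ (1 + C * A) * d := by positivity
          have t2 : 0 ≤ C * d := by positivity
          have t3 : 0 ≤ (d + lam) * K := by positivity
          have e1 : 1 + C * A ≤ (1 + C * A) * (1 + d) + C * (1 + d) + (d + lam) * K := by linarith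
          have e2 : C ≤ (1 + C * A) * (1 + d) + C * (1 + d) + (d + lam) * K := by linarith
          have e3 := hCA.trans e1
          calc _ ≤ ((1 + C * A) * (1 + d) + C * (1 + d) + (d + lam) * K) * a ^ α
                + ((1 + C * A) * (1 + d) + C * (1 + d) + (d + lam) * K) * a := by
                rw [mul_one]; gcongr
            _ ≤ _ := by
                rw [← mul_add]
                exact mul_le_mul_of_nonneg_left (by linarith) e3
      _ = _ := by ring
  · have h2 := hα.2
    have hvd := hvc h1
    rw [Set.indicator_of_mem (Set.mem_Ioc.2 ⟨h1, h2⟩), one_smul, ifl_of_one_lt h1 h2]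
    have hlip := norm_inverse_sub_le hH hB hl hr
    have hHi : r1 (Hi x) ≤ K * r1 x :=
      r1_inverse_le hNκ.le (by simpa using hHgrow 0) hlip hl x
    have hF : Hi x - x = -H (Hi x) := by
      have h3 : Hi x + H (Hi x) = x := hr x
      rw [eq_neg_iff_add_eq_zero, sub_add_eq_add_sub, h3, sub_self]
    have hHF : ‖H x - H (Hi x)‖ ≤ b * (a * (K * r1 x)) := by
      refine (hHb x (Hi x)).trans ?_
      rw [norm_sub_rev, hF, norm_neg]
      have := hHa (Hi x)
      gcongr
      exact this.trans (by gcongr)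
    have key := norm_taylor_weighted_le h1 h2 haA hC0
      (fun y h hh => hC d y h a ha0 haA hh) hv hvd x (H x) (hHa x)
    have key2 : ‖fderiv ℝ v x (H x - H (Hi x))‖ ≤
        r1 x ^ lam * M * (d + lam) * (b * (a * (K * r1 x))) :=
      ((fderiv ℝ v x).le_opNorm _).trans
        (mul_le_mul (norm_fderiv_weighted_le h1 h2 hlam hv hvd x) hHF (norm_nonneg _)
          (by positivity))
    have e : v (x + H x) - v x + fderiv ℝ v x (Hi x - x) =
        (v (x + H x) - v x - fderiv ℝ v x (H x)) + fderiv ℝ v x (H x - H (Hi x)) := by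
      rw [hF, map_neg, map_sub]; abel
    have hrα1 : r1 x ^ (-α) * r1 x ≤ 1 := by
      rw [← Real.rpow_add_one hr0.ne']
      exact Real.rpow_le_one_of_one_le_of_nonpos hr_one (by linarith)
    rw [e]
    calc _ ≤ r1 x ^ (-(lam + α)) * (r1 x ^ lam * M *
            ((1 + C * A) * d * (a * r1 x) ^ α + C * d * a ^ 2 * r1 x + C * a ^ 2)
            + r1 x ^ lam * M * (d + lam) * (b * (a * (K * r1 x)))) :=
          mul_le_mul_of_nonneg_left ((norm_add_le _ _).trans (add_le_add key key2)) hpre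
      _ = M * ((1 + C * A) * d * (r1 x ^ (-α) * (a * r1 x) ^ α)
            + C * d * a ^ 2 * (r1 x ^ (-α) * r1 x) + C * a ^ 2 * r1 x ^ (-α)
            + (d + lam) * K * (a * b) * (r1 x ^ (-α) * r1 x)) := by
          rw [← hcancel]; ring
      _ ≤ M * ((1 + C * A) * d * a ^ α + C * d * a ^ 2 * 1 + C * a ^ 2 * 1
            + (d + lam) * K * (a * b) * 1) := by rw [hrα']; gcongr
      _ ≤ M * (((1 + C * A) * (1 + d) + C * (1 + d) + (d + lam) * K)
            * (a ^ α + a * b + a ^ (1 + 1) + b ^ (1 + 1))) := by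
          gcongr
          have t1 : 0 ≤ (1 + C * A) * d := by positivity
          have t2 : 0 ≤ C * (1 + d) := by positivity
          have t3 : 0 ≤ (d + lam) * K := by positivity
          have ha2 : 0 ≤ a ^ 2 := by positivity
          have hb2 : 0 ≤ b ^ 2 := by positivity
          set P := (1 + C * A) * (1 + d) + C * (1 + d) + (d + lam) * K with hP
          have e1 : (1 + C * A) * d ≤ P := by linarith
          have e2 : C * (1 + d) ≤ P := by linarith
          have e3 : (d + lam) * K ≤ P := by linarith
          have e4 := t3.trans e3
          calc _ = (1 + C * A) * d * a ^ α + (d + lam) * K * (a * b) + C * (1 + d) * a ^ 2 := by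
                ring
            _ ≤ P * a ^ α + P * (a * b) + P * a ^ 2 + P * b ^ 2 := by
                have : 0 ≤ P * b ^ 2 := by positivity
                have := mul_le_mul_of_nonneg_right e1 haα
                have := mul_le_mul_of_nonneg_right e2 ha2
                have := mul_le_mul_of_nonneg_right e3 hab
                linarith
            _ = _ := by norm_num; ring
      _ = _ := by ring
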